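/- Let X be a real Banach space, A ⊆ X a nonempty, convex, norm-closed set, and F : X → X* a Brezis pseudomonotone operator. Let {x_k} ⊆ A be a sequence of approximate solutions of VI(F, A) in the sense that there exist ε_k ≥ 0 with ε_k → 0 and ⟨F(x_k), x_k − y⟩ ≤ ε_k for all y ∈ A and all k. If x_k ⇀ x̄ weakly in X, then x̄ ∈ A and x̄ solves VI(F, A), i.e. ⟨F(x̄), y − x̄⟩ ≥ 0 for all y ∈ A. -/

import Mathlib

open Filter Topology

/-- An operator `F : X → X*` is *Brezis pseudomonotone* if whenever `x_k ⇀ x₀` weakly and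
`limsup_k ⟨F(x_k), x_k - x₀⟩ ≤ 0`, then for every `y`,
`⟨F(x₀), x₀ - y⟩ ≤ liminf_k ⟨F(x_k), x_k - y⟩`. -/
def BrezisPseudomonotone {X : Type*} [NormedAddCommGroup X] [NormedSpace ℝ X]
    (F : X → (X →L[ℝ] ℝ)) : Prop :=
  ∀ (x : ℕ → X) (x₀ : X),
    (∀ f : X →L[ℝ] ℝ, Tendsto (fun k => f (x k)) atTop (𝓝 (f x₀))) →
    limsup (fun k => ((F (x k) (x k - x₀) : ℝ) : EReal)) atTop ≤ 0 →
    ∀ y : X, ((F x₀ (x₀ - y) : ℝ) : EReal) ≤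
      liminf (fun k => ((F (x k) (x k - y) : ℝ) : EReal)) atTop

/-- A norm-closed convex set is weakly sequentially closed. -/
theorem Convex.mem_of_tendsto_dual {X : Type*} [NormedAddCommGroup X] [NormedSpace ℝ X]
    {A : Set X} (hconv : Convex ℝ A) (hclosed : IsClosed A) {x : ℕ → X} (hxA : ∀ k, x k ∈ A)
    {x₀ : X} (hweak : ∀ f : X →L[ℝ] ℝ, Tendsto (fun k => f (x k)) atTop (𝓝 (f x₀))) :
    x₀ ∈ A := by
  by_contra hx₀
  obtain ⟨f, u, hfA, hfx₀⟩ := geometric_hahn_banach_closed_point hconv hclosed hx₀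
  exact hfx₀.not_ge (le_of_tendsto' (hweak f) fun k => (hfA _ (hxA k)).le)

/-- A real sequence bounded above by a null sequence has nonpositive limit superior. -/
theorem limsup_coe_nonpos_of_le {u ε : ℕ → ℝ} (hu : ∀ k, u k ≤ ε k)
    (hε : Tendsto ε atTop (𝓝 0)) : limsup (fun k => (u k : EReal)) atTop ≤ 0 :=
  calc limsup (fun k => (u k : EReal)) atTop ≤ limsup (fun k => (ε k : EReal)) atTop :=
        limsup_le_limsup (.of_forall fun k => EReal.coe_le_coe_iff.2 (hu k))
    _ = 0 := ((continuous_coe_real_ereal.tendsto 0).comp hε).limsup_eq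

/-- For a Brezis pseudomonotone operator `F` and a nonempty, convex, norm-closed set `A`,
every weak limit of a sequence of `ε_k`-approximate solutions of `VI(F, A)` (with `ε_k → 0`)
is a solution of `VI(F, A)`. -/
theorem brezisPseudomonotone_approxSolutions_weakLimit_solves
    {X : Type*} [NormedAddCommGroup X] [NormedSpace ℝ X] [CompleteSpace X]
    (A : Set X) (hA : A.Nonempty) (hconv : Convex ℝ A) (hclosed : IsClosed A)
    (F : X → (X →L[ℝ] ℝ)) (hF : BrezisPseudomonotone F)
    (x : ℕ → X) (hxA : ∀ k, x k ∈ A)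
    (ε : ℕ → ℝ) (hε0 : ∀ k, 0 ≤ ε k) (hεlim : Tendsto ε atTop (𝓝 0))
    (hxapprox : ∀ k, ∀ y ∈ A, F (x k) (x k - y) ≤ ε k)
    (x₀ : X)
    (hweak : ∀ f : X →L[ℝ] ℝ, Tendsto (fun k => f (x k)) atTop (𝓝 (f x₀))) :
    x₀ ∈ A ∧ ∀ y ∈ A, 0 ≤ F x₀ (y - x₀) := by
  have hx₀ : x₀ ∈ A := hconv.mem_of_tendsto_dual hclosed hxA hweak
  have hlimsup : ∀ y ∈ A, limsup (fun k => ((F (x k) (x k - y) : ℝ) : EReal)) atTop ≤ 0 :=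
    fun y hy => limsup_coe_nonpos_of_le (fun k => hxapprox k y hy) hεlim
  refine ⟨hx₀, fun y hy => ?_⟩
  have hle : ((F x₀ (x₀ - y) : ℝ) : EReal) ≤ 0 :=
    (hF x x₀ hweak (hlimsup x₀ hx₀) y).trans (le_trans liminf_le_limsup (hlimsup y hy))
  rw [← neg_sub x₀ y, map_neg]
  exact neg_nonneg.2 (EReal.coe_nonpos.1 hle)
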